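/- (Propagation of consistency is blocked above level 1.) For every n > 1 and distinct atoms p, q, the formula (p^1 ∧ q^1) → (p → q)^1 is not a tautology of R(M_{C_n}): there exists a valuation v ∈ F_{C_n} assigning it the value F_n. -/

import Mathlib

/-- Formulas of the language of da Costa's calculi `Cₙ`. -/
inductive CnForm : Type where
  | atom : ℕ → CnForm
  | neg : CnForm → CnForm
  | conj : CnForm → CnForm → CnForm
  | disj : CnForm → CnForm → CnForm
  | imp : CnForm → CnForm → CnForm
deriving DecidableEq

/-- Truth values of the Nmatrix `M_{Cₙ}`: `Tv` is `Tₙ`, `tv i` is `tᵢⁿ`, `Fv` is `Fₙ`. -/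
inductive CnVal (n : ℕ) : Type where
  | Tv : CnVal n
  | tv : Fin n → CnVal n
  | Fv : CnVal n
deriving DecidableEq

/-- Multifunction for negation. -/
def CnNeg {n : ℕ} : CnVal n → Set (CnVal n)
  | CnVal.Tv => {CnVal.Fv}
  | CnVal.tv _ => {x | x ≠ CnVal.Fv}
  | CnVal.Fv => {CnVal.Tv}

/-- Multifunction for conjunction. -/
def CnConj {n : ℕ} (x y : CnVal n) : Set (CnVal n) :=
  if x = CnVal.Fv ∨ y = CnVal.Fv then {CnVal.Fv}
  else if x = CnVal.Tv ∧ y = CnVal.Tv then {CnVal.Tv}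
  else {z | z ≠ CnVal.Fv}

/-- Multifunction for disjunction. -/
def CnDisj {n : ℕ} (x y : CnVal n) : Set (CnVal n) :=
  if x = CnVal.Fv ∧ y = CnVal.Fv then {CnVal.Fv}
  else if (x = CnVal.Tv ∨ x = CnVal.Fv) ∧ (y = CnVal.Tv ∨ y = CnVal.Fv) ∧
          (x = CnVal.Tv ∨ y = CnVal.Tv) then {CnVal.Tv}
  else {z | z ≠ CnVal.Fv}

/-- Multifunction for implication. -/
def CnImp {n : ℕ} (x y : CnVal n) : Set (CnVal n) :=
  if x ≠ CnVal.Fv ∧ y = CnVal.Fv then {CnVal.Fv}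
  else if (x = CnVal.Fv ∧ (y = CnVal.Tv ∨ y = CnVal.Fv)) ∨ (x = CnVal.Tv ∧ y = CnVal.Tv)
    then {CnVal.Tv}
  else {z | z ≠ CnVal.Fv}

/-- `v ∈ Val(M_{Cₙ})`: `v` is a valuation of the Nmatrix `M_{Cₙ}`. -/
def CnIsVal {n : ℕ} (v : CnForm → CnVal n) : Prop :=
  (∀ a, v (CnForm.neg a) ∈ CnNeg (v a)) ∧
  (∀ a b, v (CnForm.conj a b) ∈ CnConj (v a) (v b)) ∧
  (∀ a b, v (CnForm.disj a b) ∈ CnDisj (v a) (v b)) ∧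
  (∀ a b, v (CnForm.imp a b) ∈ CnImp (v a) (v b))

/-- `a.pow k` is `αᵏ`: `α⁰ = α`, `α^{k+1} = ¬(αᵏ ∧ ¬αᵏ)`. -/
def CnForm.pow (a : CnForm) : ℕ → CnForm
  | 0 => a
  | k + 1 => CnForm.neg (CnForm.conj (a.pow k) (CnForm.neg (a.pow k)))

/-- `v ∈ F_{Cₙ}`: a valuation satisfying the restriction of the RNmatrix for `Cₙ`. -/
def CnRestricted {n : ℕ} (v : CnForm → CnVal n) : Prop :=
  CnIsVal v ∧
  ∀ (a : CnForm) (i : Fin n), v a = CnVal.tv i →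
    (i.val = 0 → v (CnForm.conj a (CnForm.neg a)) = CnVal.Tv) ∧
    (∀ j : Fin n, i.val = j.val + 1 →
      (∃ m : Fin n, v (CnForm.conj a (CnForm.neg a)) = CnVal.tv m) ∧
      v (a.pow 1) = CnVal.tv j)

/-- Tautology of the RNmatrix `R(M_{Cₙ}) = ⟨F_{Cₙ}, M_{Cₙ}⟩`. -/
def CnTaut (n : ℕ) (φ : CnForm) : Prop :=
  ∀ v : CnForm → CnVal n, CnRestricted v → v φ ≠ CnVal.Fv

/-- A deterministic choice of values in `M_{Cₙ}` for which `atom p` takes the value `tv t₁`, the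
other atoms take the value `Tv`, and an implication from a formula of value `tv t₁` takes the
value `tv t₀` unless its consequent is false. -/
def blockingValuation {n : ℕ} (t₀ t₁ : Fin n) (p : ℕ) : CnForm → CnVal n
  | .atom r => if r = p then .tv t₁ else .Tv
  | .neg a =>
    match blockingValuation t₀ t₁ p a with
    | .Tv => .Fv
    | .tv _ => .tv t₀
    | .Fv => .Tv
  | .conj a b =>
    if blockingValuation t₀ t₁ p a = .Fv ∨ blockingValuation t₀ t₁ p b = .Fv then .Fv
    else if b = .neg a ∧ blockingValuation t₀ t₁ p a = .tv t₁ then .tv t₀ else .Tv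
  | .disj a b =>
    if blockingValuation t₀ t₁ p a = .Fv ∧ blockingValuation t₀ t₁ p b = .Fv then .Fv else .Tv
  | .imp a b =>
    if blockingValuation t₀ t₁ p a ≠ .Fv ∧ blockingValuation t₀ t₁ p b = .Fv then .Fv
    else if blockingValuation t₀ t₁ p a = .tv t₁ then .tv t₀ else .Tv

theorem blockingValuation_isVal {n : ℕ} (t₀ t₁ : Fin n) (p : ℕ) :
    CnIsVal (blockingValuation t₀ t₁ p) := by
  refine ⟨fun a => ?_, fun a b => ?_, fun a b => ?_, fun a b => ?_⟩
  · cases h : blockingValuation t₀ t₁ p a <;> simp [blockingValuation, CnNeg, h]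
  · simp only [blockingValuation, CnConj]
    split_ifs <;> simp_all
  · simp only [blockingValuation, CnDisj]
    split_ifs <;> simp_all
  · simp only [blockingValuation, CnImp]
    split_ifs <;> simp_all

theorem blockingValuation_eq_tv {n : ℕ} {t₀ t₁ : Fin n} {p : ℕ} {a : CnForm} {i : Fin n}
    (h : blockingValuation t₀ t₁ p a = .tv i) : i = t₀ ∨ i = t₁ := by
  cases a <;> simp only [blockingValuation] at h <;> split at h <;> grind

theorem blockingValuation_restricted {n : ℕ} {t₀ t₁ : Fin n} (h₀ : t₀.val = 0) (h₁ : t₁.val = 1)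
    (p : ℕ) : CnRestricted (blockingValuation t₀ t₁ p) := by
  refine ⟨blockingValuation_isVal t₀ t₁ p, fun a i hi => ?_⟩
  have hne : t₀ ≠ t₁ := fun h => by simp [h, h₁] at h₀
  rcases blockingValuation_eq_tv hi with rfl | rfl
  · exact ⟨fun _ => by simp [blockingValuation, hi, hne], fun j hj => by omega⟩
  · refine ⟨fun h => by omega, fun j hj => ?_⟩
    obtain rfl : j = t₀ := Fin.ext (by omega)
    exact ⟨⟨j, by simp [blockingValuation, hi]⟩, by simp [CnForm.pow, blockingValuation, hi]⟩

theorem consistency_propagation_blocked_above_one (n : ℕ) (hn : 1 < n)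
    (p q : ℕ) (hpq : p ≠ q) :
    ∃ v : CnForm → CnVal n, CnRestricted v ∧
      v (CnForm.imp
        (CnForm.conj ((CnForm.atom p).pow 1) ((CnForm.atom q).pow 1))
        ((CnForm.imp (CnForm.atom p) (CnForm.atom q)).pow 1)) = CnVal.Fv := by
  have hne : (⟨0, by omega⟩ : Fin n) ≠ ⟨1, hn⟩ := by simp
  refine ⟨blockingValuation ⟨0, by omega⟩ ⟨1, hn⟩ p, blockingValuation_restricted rfl rfl p, ?_⟩
  simp [CnForm.pow, blockingValuation, hpq.symm]
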